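/- Assume conditions (1.2) and that q(x) → ∞ as |x| → ∞ (so that condition (1.3) holds), and let u, v be a principal fundamental system of solutions of (r z')' = q z. Then for every p ∈ (1,∞) the Green operator G is a bounded and compact operator on L_p(ℝ). -/

import Mathlib

open MeasureTheory Filter Topology
open scoped ENNReal RealInnerProductSpace

noncomputable section

/-- Conditions (1.2): `r, q` measurable, `r > 0`, `q ≥ 0`, with `1/r` and `q`
locally Lebesgue integrable on `ℝ`. -/
def Cond12 (r q : ℝ → ℝ) : Prop :=
  Measurable r ∧ Measurable q ∧ (∀ x, 0 < r x) ∧ (∀ x, 0 ≤ q x) ∧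
    LocallyIntegrable (fun t => 1 / r t) volume ∧ LocallyIntegrable q volume

/-- Condition (1.3): for every `x`,
`(∫_{x-d}^x dt/r(t)) · (∫_{x-d}^x q(t) dt) → ∞` as `|d| → ∞`. -/
def Cond13 (r q : ℝ → ℝ) : Prop :=
  ∀ x : ℝ, Tendsto (fun d : ℝ => (∫ t in x - d..x, 1 / r t) * (∫ t in x - d..x, q t))
    (cocompact ℝ) atTop

/-- Condition (2.1): `∫_{-∞}^x q > 0` and `∫_x^∞ q > 0` for every `x`. -/
def Cond21 (q : ℝ → ℝ) : Prop :=
  ∀ x : ℝ, 0 < ∫⁻ t in Set.Iic x, ENNReal.ofReal (q t) ∧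
    0 < ∫⁻ t in Set.Ici x, ENNReal.ofReal (q t)

/-- A principal fundamental system of solutions `u, v` (with a.e. derivatives
`u', v'`) of the equation `(r z')' = q z`:  `u, v, r u', r v'` are locally
absolutely continuous (expressed through the integral identities below),
`(r u')' = q u` and `(r v')' = q v` a.e., `u > 0`, `v > 0`, `v' ≥ 0`, `u' ≤ 0`,
`r (v' u - u' v) ≡ 1`, `v/u → 0` at `-∞`, `u/v → 0` at `+∞`,
`∫_{-∞}^0 dt/(r u²) < ∞` and `∫_0^∞ dt/(r v²) < ∞`. -/
structure PFSS (r q u v u' v' : ℝ → ℝ) : Prop where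
  u_pos : ∀ x, 0 < u x
  v_pos : ∀ x, 0 < v x
  u'_nonpos : ∀ x, u' x ≤ 0
  v'_nonneg : ∀ x, 0 ≤ v' x
  u'_intble : ∀ a b : ℝ, IntervalIntegrable u' volume a b
  v'_intble : ∀ a b : ℝ, IntervalIntegrable v' volume a b
  u_deriv : ∀ a b : ℝ, u b - u a = ∫ t in a..b, u' t
  v_deriv : ∀ a b : ℝ, v b - v a = ∫ t in a..b, v' t
  ru'_deriv : ∀ a b : ℝ, r b * u' b - r a * u' a = ∫ t in a..b, q t * u t
  rv'_deriv : ∀ a b : ℝ, r b * v' b - r a * v' a = ∫ t in a..b, q t * v t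
  wronskian : ∀ x, r x * (v' x * u x - u' x * v x) = 1
  ratio_bot : Tendsto (fun x => v x / u x) atBot (𝓝 0)
  ratio_top : Tendsto (fun x => u x / v x) atTop (𝓝 0)
  int_u : ∫⁻ t in Set.Iic (0:ℝ), ENNReal.ofReal (1 / (r t * u t ^ 2)) < ⊤
  int_v : ∫⁻ t in Set.Ici (0:ℝ), ENNReal.ofReal (1 / (r t * v t ^ 2)) < ⊤

/-- The Green kernel `G(x,t) = u(x) v(t)` for `x ≥ t`, `u(t) v(x)` for `x ≤ t`. -/
def greenKernel (u v : ℝ → ℝ) (x t : ℝ) : ℝ :=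
  if t ≤ x then u x * v t else u t * v x

/-- The space `L_p(ℝ)` (with respect to Lebesgue measure). -/
abbrev LpR (p : ℝ≥0∞) : Type := Lp ℝ p (volume : Measure ℝ)

/-- `G` is (a bounded realization on `L_p` of) the Green operator
`(G f)(x) = ∫_ℝ G(x,t) f(t) dt`. -/
def IsGreenOp (u v : ℝ → ℝ) (p : ℝ≥0∞) [Fact (1 ≤ p)]
    (G : LpR p →L[ℝ] LpR p) : Prop :=
  ∀ f : LpR p,
    (G f : ℝ → ℝ) =ᵐ[volume] fun x => ∫ t, greenKernel u v x t * (f : ℝ → ℝ) t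

/-- `d₁` solves `(∫_{x-d}^x dt/r)(∫_{x-d}^x q dt) = 1`, `d₁ > 0`. -/
def IsD1 (r q d₁ : ℝ → ℝ) : Prop :=
  ∀ x : ℝ, 0 < d₁ x ∧
    (∫ t in x - d₁ x..x, 1 / r t) * (∫ t in x - d₁ x..x, q t) = 1

/-- `d₂` solves `(∫_x^{x+d} dt/r)(∫_x^{x+d} q dt) = 1`, `d₂ > 0`. -/
def IsD2 (r q d₂ : ℝ → ℝ) : Prop :=
  ∀ x : ℝ, 0 < d₂ x ∧
    (∫ t in x..x + d₂ x, 1 / r t) * (∫ t in x..x + d₂ x, q t) = 1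

/-- `φ(x) = ∫_{x-d₁(x)}^x dt/r(t)`. -/
def phiF (r d₁ : ℝ → ℝ) (x : ℝ) : ℝ := ∫ t in x - d₁ x..x, 1 / r t

/-- `ψ(x) = ∫_x^{x+d₂(x)} dt/r(t)`. -/
def psiF (r d₂ : ℝ → ℝ) (x : ℝ) : ℝ := ∫ t in x..x + d₂ x, 1 / r t

/-- `h(x) = φ(x)ψ(x)/(φ(x)+ψ(x))`. -/
def hF (r d₁ d₂ : ℝ → ℝ) (x : ℝ) : ℝ :=
  phiF r d₁ x * psiF r d₂ x / (phiF r d₁ x + psiF r d₂ x)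

/-- `d` solves `∫_{x-d(x)}^{x+d(x)} dt/(r(t)h(t)) = 1`, `d > 0`. -/
def IsD (r h d : ℝ → ℝ) : Prop :=
  ∀ x : ℝ, 0 < d x ∧ (∫ t in x - d x..x + d x, 1 / (r t * h t)) = 1

/-- `s` solves `∫_{x-s(x)}^{x+s(x)} dt/(r(t)ρ(t)) = 1`, `s > 0`. -/
def IsS (r ρ s : ℝ → ℝ) : Prop :=
  ∀ x : ℝ, 0 < s x ∧ (∫ t in x - s x..x + s x, 1 / (r t * ρ t)) = 1


/-- The kernel `K` is jointly measurable, with `∫ |K x t| dt ≤ A` for all `x` and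
`∫ |K x t| dx ≤ B` for all `t`. -/
structure SchurBound {α : Type*} [MeasurableSpace α] (μ : Measure α) (K : α → α → ℝ)
    (A B : ℝ≥0∞) : Prop where
  measurable : Measurable (Function.uncurry K)
  row : ∀ x, ∫⁻ t, ‖K x t‖ₑ ∂μ ≤ A
  col : ∀ t, ∫⁻ x, ‖K x t‖ₑ ∂μ ≤ B

/-- `T` is a realization on `L_p` of the integral operator with kernel `K`. -/
def IsKernelOp {α : Type*} [MeasurableSpace α] {μ : Measure α} {p : ℝ≥0∞} [Fact (1 ≤ p)]
    (K : α → α → ℝ) (T : Lp ℝ p μ →L[ℝ] Lp ℝ p μ) : Prop :=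
  ∀ f : Lp ℝ p μ, (T f : α → ℝ) =ᵐ[μ] fun x => ∫ t, K x t * f t ∂μ

section Schur

variable {α : Type*} [MeasurableSpace α] {μ : Measure α}

theorem lintegral_mul_rpow_le {P : ℝ} (hP : 1 < P) {k g : α → ℝ≥0∞} (hk : Measurable k)
    (hg : Measurable g) :
    (∫⁻ t, k t * g t ∂μ) ^ P ≤ (∫⁻ t, k t ∂μ) ^ (P - 1) * ∫⁻ t, k t * g t ^ P ∂μ := by
  have hP0 : 0 < P := by linarith
  have hexp : 1 - 1 / P + 1 / P = 1 := by ring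
  have h1 : 0 ≤ 1 - 1 / P := by
    rw [sub_nonneg, div_le_one hP0]; exact hP.le
  have h := ENNReal.lintegral_mul_norm_pow_le (μ := μ) (f := k) (g := fun t => k t * g t ^ P)
    hk.aemeasurable (hk.mul (hg.pow_const P)).aemeasurable h1 (one_div_nonneg.2 hP0.le) hexp
  have hpt : ∀ t, k t ^ (1 - 1 / P) * (k t * g t ^ P) ^ (1 / P) = k t * g t := by
    intro t
    rw [ENNReal.mul_rpow_of_nonneg _ _ (one_div_nonneg.2 hP0.le), ← mul_assoc,
      ← ENNReal.rpow_add_of_nonneg _ _ h1 (one_div_nonneg.2 hP0.le), hexp, ← ENNReal.rpow_mul,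
      mul_one_div_cancel hP0.ne', ENNReal.rpow_one, ENNReal.rpow_one]
  simp only [hpt] at h
  calc (∫⁻ t, k t * g t ∂μ) ^ P
      ≤ ((∫⁻ t, k t ∂μ) ^ (1 - 1 / P) * (∫⁻ t, k t * g t ^ P ∂μ) ^ (1 / P)) ^ P := by gcongr
    _ = _ := by
      rw [ENNReal.mul_rpow_of_nonneg _ _ hP0.le, ← ENNReal.rpow_mul, ← ENNReal.rpow_mul,
        one_div_mul_cancel hP0.ne', ENNReal.rpow_one]
      congr 2
      field_simp

variable [SFinite μ]

/-- Schur's test for nonnegative kernels. -/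
theorem lintegral_rpow_lintegral_mul_le {P : ℝ} (hP : 1 < P) {k : α → α → ℝ≥0∞}
    (hk : Measurable (Function.uncurry k)) {g : α → ℝ≥0∞} (hg : Measurable g) {A B : ℝ≥0∞}
    (hA : ∀ x, ∫⁻ t, k x t ∂μ ≤ A) (hB : ∀ t, ∫⁻ x, k x t ∂μ ≤ B) :
    ∫⁻ x, (∫⁻ t, k x t * g t ∂μ) ^ P ∂μ ≤ A ^ (P - 1) * B * ∫⁻ t, g t ^ P ∂μ := by
  have hkg : Measurable (Function.uncurry fun x t => k x t * g t ^ P) :=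
    hk.mul ((hg.pow_const P).comp measurable_snd)
  calc ∫⁻ x, (∫⁻ t, k x t * g t ∂μ) ^ P ∂μ
      ≤ ∫⁻ x, A ^ (P - 1) * ∫⁻ t, k x t * g t ^ P ∂μ ∂μ := by
        refine lintegral_mono fun x => ?_
        refine (lintegral_mul_rpow_le (k := k x) hP (hk.comp measurable_prodMk_left) hg).trans ?_
        gcongr
        exact hA x
    _ = A ^ (P - 1) * ∫⁻ x, ∫⁻ t, k x t * g t ^ P ∂μ ∂μ :=
        lintegral_const_mul _ hkg.lintegral_prod_right'
    _ = A ^ (P - 1) * ∫⁻ t, ∫⁻ x, k x t * g t ^ P ∂μ ∂μ := by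
        rw [lintegral_lintegral_swap hkg.aemeasurable]
    _ ≤ A ^ (P - 1) * ∫⁻ t, B * g t ^ P ∂μ := by
        gcongr with t
        rw [lintegral_mul_const (f := fun x => k x t) _ (hk.comp measurable_prodMk_right)]
        gcongr
        exact hB t
    _ = A ^ (P - 1) * B * ∫⁻ t, g t ^ P ∂μ := by
        rw [lintegral_const_mul _ (hg.pow_const P), mul_assoc]

variable {p : ℝ≥0∞} {K K' : α → α → ℝ} {A B : ℝ≥0∞}

/-- The bound on the operator norm given by Schur's test. -/
def schurConst (p A B : ℝ≥0∞) : ℝ≥0∞ := (A ^ (p.toReal - 1) * B) ^ (1 / p.toReal)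

theorem schurConst_ne_top (hp1 : 1 < p) (hp2 : p ≠ ⊤) (hA : A ≠ ⊤) (hB : B ≠ ⊤) :
    schurConst p A B ≠ ⊤ := by
  have hP : 1 < p.toReal := (ENNReal.toReal_lt_toReal ENNReal.one_ne_top hp2).2 hp1
  unfold schurConst
  refine ENNReal.rpow_ne_top_of_nonneg (by positivity) (ENNReal.mul_ne_top ?_ hB)
  exact ENNReal.rpow_ne_top_of_nonneg (by linarith) hA

theorem SchurBound.eLpNorm_lintegral_le (h : SchurBound μ K A B) (hp1 : 1 < p) (hp2 : p ≠ ⊤)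
    (f : Lp ℝ p μ) :
    eLpNorm (fun x => ∫⁻ t, ‖K x t‖ₑ * ‖f t‖ₑ ∂μ) p μ ≤ schurConst p A B * eLpNorm f p μ := by
  have hP : 1 < p.toReal := (ENNReal.toReal_lt_toReal ENNReal.one_ne_top hp2).2 hp1
  have hp0 : p ≠ 0 := (zero_lt_one.trans hp1).ne'
  rw [eLpNorm_eq_lintegral_rpow_enorm_toReal hp0 hp2,
    eLpNorm_eq_lintegral_rpow_enorm_toReal hp0 hp2, schurConst,
    ← ENNReal.mul_rpow_of_nonneg _ _ (by positivity)]
  gcongr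
  exact lintegral_rpow_lintegral_mul_le hP (k := fun x t => ‖K x t‖ₑ) h.measurable.enorm
    (Lp.stronglyMeasurable f).measurable.enorm h.row h.col

theorem SchurBound.ae_integrable (h : SchurBound μ K A B) (hA : A ≠ ⊤) (hB : B ≠ ⊤)
    (hp1 : 1 < p) (hp2 : p ≠ ⊤) (f : Lp ℝ p μ) :
    ∀ᵐ x ∂μ, Integrable (fun t => K x t * f t) μ := by
  have hP : 1 < p.toReal := (ENNReal.toReal_lt_toReal ENNReal.one_ne_top hp2).2 hp1
  have hp0 : p ≠ 0 := (zero_lt_one.trans hp1).ne'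
  have hfm := (Lp.stronglyMeasurable f).measurable
  have hm : Measurable fun x => ∫⁻ t, ‖K x t‖ₑ * ‖f t‖ₑ ∂μ :=
    Measurable.lintegral_prod_right' (f := fun z : α × α => ‖K z.1 z.2‖ₑ * ‖f z.2‖ₑ)
      (h.measurable.enorm.mul (hfm.enorm.comp measurable_snd))
  have hfin : ∫⁻ x, (∫⁻ t, ‖K x t‖ₑ * ‖f t‖ₑ ∂μ) ^ p.toReal ∂μ ≠ ⊤ := by
    refine ne_top_of_le_ne_top ?_ (lintegral_rpow_lintegral_mul_le hP
      (k := fun x t => ‖K x t‖ₑ) h.measurable.enorm hfm.enorm h.row h.col)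
    refine ENNReal.mul_ne_top (ENNReal.mul_ne_top
      (ENNReal.rpow_ne_top_of_nonneg (by linarith) hA) hB) ?_
    exact (lintegral_rpow_enorm_lt_top_of_eLpNorm_lt_top hp0 hp2 (Lp.eLpNorm_lt_top f)).ne
  filter_upwards [ae_lt_top (hm.pow_const _) hfin] with x hx
  refine ⟨((h.measurable.comp measurable_prodMk_left).mul hfm).aestronglyMeasurable, ?_⟩
  rw [ENNReal.rpow_lt_top_iff_of_pos (by linarith)] at hx
  simpa [HasFiniteIntegral, enorm_mul] using hx

theorem SchurBound.eLpNorm_integral_le (h : SchurBound μ K A B) (hp1 : 1 < p) (hp2 : p ≠ ⊤)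
    (f : Lp ℝ p μ) :
    eLpNorm (fun x => ∫ t, K x t * f t ∂μ) p μ ≤ schurConst p A B * eLpNorm f p μ := by
  refine (eLpNorm_mono_enorm fun x => ?_).trans (h.eLpNorm_lintegral_le hp1 hp2 f)
  refine (enorm_integral_le_lintegral_enorm _).trans ?_
  simp [enorm_mul]

variable [Fact (1 ≤ p)]

theorem SchurBound.exists_isKernelOp (h : SchurBound μ K A B) (hA : A ≠ ⊤) (hB : B ≠ ⊤)
    (hp1 : 1 < p) (hp2 : p ≠ ⊤) :
    ∃ T : Lp ℝ p μ →L[ℝ] Lp ℝ p μ, IsKernelOp K T := by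
  have hmem : ∀ f : Lp ℝ p μ, MemLp (fun x => ∫ t, K x t * f t ∂μ) p μ := fun f =>
    ⟨(StronglyMeasurable.integral_prod_right' (f := fun z : α × α => K z.1 z.2 * f z.2)
      (h.measurable.mul ((Lp.stronglyMeasurable f).measurable.comp
        measurable_snd)).stronglyMeasurable).aestronglyMeasurable,
    (h.eLpNorm_integral_le hp1 hp2 f).trans_lt
      (ENNReal.mul_lt_top (schurConst_ne_top hp1 hp2 hA hB).lt_top (Lp.eLpNorm_lt_top f))⟩
  let T₀ : Lp ℝ p μ →ₗ[ℝ] Lp ℝ p μ :=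
    { toFun := fun f => (hmem f).toLp _
      map_add' := fun f g => by
        rw [← MemLp.toLp_add]
        refine MemLp.toLp_congr _ _ ?_
        filter_upwards [h.ae_integrable hA hB hp1 hp2 f, h.ae_integrable hA hB hp1 hp2 g]
          with x hf hg
        rw [Pi.add_apply, ← integral_add hf hg]
        refine integral_congr_ae ?_
        filter_upwards [Lp.coeFn_add f g] with t ht
        rw [ht, Pi.add_apply, mul_add]
      map_smul' := fun c f => by
        rw [RingHom.id_apply, ← MemLp.toLp_const_smul]
        refine MemLp.toLp_congr _ _ (Eventually.of_forall fun x => ?_)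
        simp only [Pi.smul_apply, smul_eq_mul]
        rw [← integral_const_mul]
        refine integral_congr_ae ?_
        filter_upwards [Lp.coeFn_smul c f] with t ht
        rw [ht, Pi.smul_apply, smul_eq_mul]
        ring }
  refine ⟨T₀.mkContinuous (schurConst p A B).toReal fun f => ?_, fun f => (hmem f).coeFn_toLp⟩
  change ‖(hmem f).toLp _‖ ≤ _
  rw [Lp.norm_toLp, Lp.norm_def, ← ENNReal.toReal_mul]
  exact ENNReal.toReal_mono (ENNReal.mul_ne_top (schurConst_ne_top hp1 hp2 hA hB)
    (Lp.eLpNorm_ne_top f)) (h.eLpNorm_integral_le hp1 hp2 f)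

theorem SchurBound.norm_sub_le {T T' : Lp ℝ p μ →L[ℝ] Lp ℝ p μ} {A' B' A'' B'' : ℝ≥0∞}
    (h : SchurBound μ K A B) (hA : A ≠ ⊤) (hB : B ≠ ⊤)
    (h' : SchurBound μ K' A' B') (hA' : A' ≠ ⊤) (hB' : B' ≠ ⊤)
    (hd : SchurBound μ (fun x t => K x t - K' x t) A'' B'') (hA'' : A'' ≠ ⊤) (hB'' : B'' ≠ ⊤)
    (hp1 : 1 < p) (hp2 : p ≠ ⊤) (hT : IsKernelOp K T) (hT' : IsKernelOp K' T') :
    ‖T - T'‖ ≤ (schurConst p A'' B'').toReal := by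
  refine ContinuousLinearMap.opNorm_le_bound _ ENNReal.toReal_nonneg fun f => ?_
  rw [Lp.norm_def, Lp.norm_def, ← ENNReal.toReal_mul]
  refine ENNReal.toReal_mono (ENNReal.mul_ne_top (schurConst_ne_top hp1 hp2 hA'' hB'')
    (Lp.eLpNorm_ne_top f)) ((eLpNorm_congr_ae ?_).trans_le (hd.eLpNorm_integral_le hp1 hp2 f))
  rw [sub_apply]
  filter_upwards [Lp.coeFn_sub (T f) (T' f), hT f, hT' f, h.ae_integrable hA hB hp1 hp2 f,
    h'.ae_integrable hA' hB' hp1 hp2 f] with x hx h1 h2 h3 h4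
  rw [hx, Pi.sub_apply, h1, h2, ← integral_sub h3 h4]
  simp only [sub_mul]

/-- The kernel `K` defines a compact integral operator on `L_p` with finite Schur bounds. -/
def IsCompactKernel (μ : Measure α) (p : ℝ≥0∞) [Fact (1 ≤ p)] (K : α → α → ℝ) : Prop :=
  (∃ A B : ℝ≥0∞, A ≠ ⊤ ∧ B ≠ ⊤ ∧ SchurBound μ K A B) ∧
    ∃ T : Lp ℝ p μ →L[ℝ] Lp ℝ p μ, IsKernelOp K T ∧ IsCompactOperator T

theorem SchurBound.isCompactKernel_of_approx (h : SchurBound μ K A B) (hA : A ≠ ⊤) (hB : B ≠ ⊤)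
    (hp1 : 1 < p) (hp2 : p ≠ ⊤)
    (happ : ∀ ε : ℝ, 0 < ε → ∃ (K' : α → α → ℝ) (A' B' : ℝ≥0∞), A' ≠ ⊤ ∧ B' ≠ ⊤ ∧
      SchurBound μ (fun x t => K x t - K' x t) A' B' ∧ (schurConst p A' B').toReal < ε ∧
      IsCompactKernel μ p K') :
    IsCompactKernel μ p K := by
  obtain ⟨T, hT⟩ := h.exists_isKernelOp hA hB hp1 hp2
  refine ⟨⟨A, B, hA, hB, h⟩, T, hT, ?_⟩
  have hcl := isClosed_setOfPred_isCompactOperator (σ₁₂ := RingHom.id ℝ) (M₁ := Lp ℝ p μ)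
    (M₂ := Lp ℝ p μ)
  have hmem : T ∈ closure {T : Lp ℝ p μ →L[ℝ] Lp ℝ p μ | IsCompactOperator T} := by
    refine Metric.mem_closure_iff.2 fun ε hε => ?_
    obtain ⟨K', A', B', hA', hB', hd, hlt, ⟨A₁, B₁, hA₁, hB₁, hs⟩, T', hT', hc⟩ := happ ε hε
    refine ⟨T', hc, ?_⟩
    rw [dist_eq_norm]
    exact (h.norm_sub_le hA hB hs hA₁ hB₁ hd hA' hB' hp1 hp2 hT hT').trans_lt hlt
  rwa [hcl.closure_eq] at hmem

theorem isCompactOperator_of_range_le_finiteDimensional {E F : Type*} [NormedAddCommGroup E]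
    [NormedSpace ℝ E] [NormedAddCommGroup F] [NormedSpace ℝ F] (T : E →L[ℝ] F)
    (S : Submodule ℝ F) [FiniteDimensional ℝ S] (hS : ∀ x, T x ∈ S) : IsCompactOperator T := by
  have : ProperSpace S := FiniteDimensional.proper ℝ S
  exact (isCompactOperator_of_locallyCompactSpace_dom (T.codRestrict S hS)).clm_comp S.subtypeL

/-- A kernel supported in `E × α` with `E` of finite measure, for which the functions `K x` with
`x ∈ E` depend only on the finitely many values of `c` on `E`, defines a compact operator. -/
theorem SchurBound.isCompactKernel_of_finite (h : SchurBound μ K A B) (hA : A ≠ ⊤) (hB : B ≠ ⊤)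
    (hp1 : 1 < p) (hp2 : p ≠ ⊤) {ι : Type*} [MeasurableSpace ι] [MeasurableSingletonClass ι]
    {c : α → ι} (hc : Measurable c) {E : Set α} (hE : MeasurableSet E) (hμE : μ E ≠ ⊤)
    (s : Finset ι) (hs : ∀ x ∈ E, c x ∈ s) (H : ι → α → ℝ)
    (hKE : ∀ x ∈ E, K x = H (c x)) (hK0 : ∀ x ∉ E, K x = 0) :
    IsCompactKernel μ p K := by
  classical
  obtain ⟨T, hT⟩ := h.exists_isKernelOp hA hB hp1 hp2
  refine ⟨⟨A, B, hA, hB, h⟩, T, hT, ?_⟩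
  have hm : ∀ j, MeasurableSet (E ∩ c ⁻¹' {j}) := fun j =>
    hE.inter (hc (measurableSet_singleton j))
  have hfin : ∀ j, μ (E ∩ c ⁻¹' {j}) ≠ ⊤ := fun j =>
    ne_top_of_le_ne_top hμE (measure_mono Set.inter_subset_left)
  let b : ι → Lp ℝ p μ := fun j => indicatorConstLp p (hm j) (hfin j) (1 : ℝ)
  have : FiniteDimensional ℝ (Submodule.span ℝ (b '' (s : Set ι))) :=
    FiniteDimensional.span_of_finite ℝ (s.finite_toSet.image b)
  refine isCompactOperator_of_range_le_finiteDimensional T (Submodule.span ℝ (b '' s)) fun f => ?_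
  have hTf : T f = ∑ j ∈ s, (∫ t, H j t * f t ∂μ) • b j := by
    refine Lp.ext ?_
    have hsum : ∀ᵐ x ∂μ, ∀ j ∈ s,
        (((∫ t, H j t * f t ∂μ) • b j : Lp ℝ p μ) : α → ℝ) x =
          (∫ t, H j t * f t ∂μ) * (E ∩ c ⁻¹' {j}).indicator (fun _ => (1 : ℝ)) x := by
      refine (Finset.eventually_all s).2 fun j _ => ?_
      filter_upwards [Lp.coeFn_smul (∫ t, H j t * f t ∂μ) (b j),
        indicatorConstLp_coeFn (p := p) (hs := hm j) (hμs := hfin j) (c := (1 : ℝ))] with x h1 h2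
      rw [h1, Pi.smul_apply, smul_eq_mul, h2]
    filter_upwards [hT f, hsum, Lp.coeFn_finsetSum s fun j => (∫ t, H j t * f t ∂μ) • b j]
      with x h1 h2 h3
    rw [h1, h3, Finset.sum_apply, Finset.sum_congr rfl h2]
    by_cases hx : x ∈ E
    · rw [Finset.sum_eq_single_of_mem (c x) (hs x hx), hKE x hx]
      · simp [hx]
      · intro j _ hj
        simp [Ne.symm hj]
    · simp [hx, hK0 x hx]
  rw [hTf]
  exact Submodule.sum_mem _ fun j hj =>
    Submodule.smul_mem _ _ (Submodule.subset_span ⟨j, hj, rfl⟩)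

end Schur

section SchurConst

variable {p : ℝ≥0∞}

theorem toReal_schurConst {a b : ℝ} (ha : 0 ≤ a) (hb : 0 ≤ b) (hp1 : 1 < p) (hp2 : p ≠ ⊤) :
    (schurConst p (ENNReal.ofReal a) (ENNReal.ofReal b)).toReal =
      (a ^ (p.toReal - 1) * b) ^ (1 / p.toReal) := by
  have hP : 1 < p.toReal := (ENNReal.toReal_lt_toReal ENNReal.one_ne_top hp2).2 hp1
  rw [schurConst, ← ENNReal.toReal_rpow, ENNReal.toReal_mul, ← ENNReal.toReal_rpow,
    ENNReal.toReal_ofReal ha, ENNReal.toReal_ofReal hb]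

theorem exists_toReal_schurConst_lt {a b : ℝ → ℝ} (ha : Continuous a) (hb : Continuous b)
    (ha0 : ∀ η, 0 < η → 0 ≤ a η) (hb0 : ∀ η, 0 < η → 0 ≤ b η) (hab : a 0 = 0 ∨ b 0 = 0)
    (hp1 : 1 < p) (hp2 : p ≠ ⊤) {ε : ℝ} (hε : 0 < ε) :
    ∃ η : ℝ, 0 < η ∧
      (schurConst p (ENNReal.ofReal (a η)) (ENNReal.ofReal (b η))).toReal < ε := by
  have hP : 1 < p.toReal := (ENNReal.toReal_lt_toReal ENNReal.one_ne_top hp2).2 hp1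
  have hcont : Continuous fun η => (a η ^ (p.toReal - 1) * b η) ^ (1 / p.toReal) :=
    ((ha.rpow_const fun _ => Or.inr (by linarith)).mul hb).rpow_const
      fun _ => Or.inr (by positivity)
  have h0 : (a 0 ^ (p.toReal - 1) * b 0) ^ (1 / p.toReal) = 0 := by
    have hbase : a 0 ^ (p.toReal - 1) * b 0 = 0 := by
      rcases hab with h | h
      · rw [h, Real.zero_rpow (by linarith), zero_mul]
      · rw [h, mul_zero]
    rw [hbase, Real.zero_rpow (by positivity)]
  have hev : ∀ᶠ η in 𝓝[>] (0 : ℝ), (a η ^ (p.toReal - 1) * b η) ^ (1 / p.toReal) < ε :=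
    (hcont.tendsto 0).mono_left nhdsWithin_le_nhds |>.eventually_lt_const (by rwa [h0])
  obtain ⟨η, hη, hpos⟩ := (hev.and self_mem_nhdsWithin).exists
  exact ⟨η, hpos, by rwa [toReal_schurConst (ha0 η hpos) (hb0 η hpos) hp1 hp2]⟩

end SchurConst

theorem SchurBound.of_enorm_le {α : Type*} [MeasurableSpace α] {μ : Measure α} {K K' : α → α → ℝ}
    {A B : ℝ≥0∞} (h : SchurBound μ K A B) (hm : Measurable (Function.uncurry K'))
    (hle : ∀ x t, ‖K' x t‖ₑ ≤ ‖K x t‖ₑ) : SchurBound μ K' A B where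
  measurable := hm
  row x := (lintegral_mono fun t => hle x t).trans (h.row x)
  col t := (lintegral_mono fun x => hle x t).trans (h.col t)

theorem SchurBound.of_enorm_le_add {α : Type*} [MeasurableSpace α] {μ : Measure α}
    {K₁ K₂ K' : α → α → ℝ} {A₁ B₁ A₂ B₂ : ℝ≥0∞} (h₁ : SchurBound μ K₁ A₁ B₁)
    (h₂ : SchurBound μ K₂ A₂ B₂) (hm : Measurable (Function.uncurry K'))
    (hle : ∀ x t, ‖K' x t‖ₑ ≤ ‖K₁ x t‖ₑ + ‖K₂ x t‖ₑ) :
    SchurBound μ K' (A₁ + A₂) (B₁ + B₂) where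
  measurable := hm
  row x := by
    have hm₁ : Measurable fun t => ‖K₁ x t‖ₑ :=
      (h₁.measurable.comp measurable_prodMk_left).enorm
    refine (lintegral_mono fun t => hle x t).trans ?_
    rw [lintegral_add_left hm₁]
    exact add_le_add (h₁.row x) (h₂.row x)
  col t := by
    have hm₁ : Measurable fun x => ‖K₁ x t‖ₑ :=
      (h₁.measurable.comp measurable_prodMk_right).enorm
    refine (lintegral_mono fun x => hle x t).trans ?_
    rw [lintegral_add_left hm₁]
    exact add_le_add (h₁.col t) (h₂.col t)

/-- The operator with kernel `K` restricted to a compact rectangle is compact when `K` is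
continuous. -/
theorem isCompactKernel_indicator_of_continuous {K : ℝ → ℝ → ℝ}
    (hK : Continuous (Function.uncurry K)) {A B : ℝ≥0∞} (h : SchurBound volume K A B)
    (hA : A ≠ ⊤) (hB : B ≠ ⊤) {p : ℝ≥0∞} [Fact (1 ≤ p)] (hp1 : 1 < p) (hp2 : p ≠ ⊤)
    {N' N : ℝ} (hN' : 0 ≤ N') (hN : 0 ≤ N) :
    IsCompactKernel volume p fun x t =>
      (Set.Icc (-N') N' ×ˢ Set.Icc (-N) N).indicator (Function.uncurry K) (x, t) := by
  set I := Set.Icc (-N) N with hI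
  set J := Set.Icc (-N') N' with hJ
  have hIm : MeasurableSet (J ×ˢ I) := measurableSet_Icc.prod measurableSet_Icc
  have hbound : SchurBound volume (fun x t => (J ×ˢ I).indicator (Function.uncurry K) (x, t))
      A B := h.of_enorm_le (hK.measurable.indicator hIm) fun x t => by
    by_cases hxt : (x, t) ∈ J ×ˢ I <;> simp [hxt, Function.uncurry]
  refine hbound.isCompactKernel_of_approx hA hB hp1 hp2 fun ε hε => ?_
  obtain ⟨η, hη, hlt⟩ := exists_toReal_schurConst_lt (a := fun η => η * (2 * N))
    (b := fun η => η * (2 * N')) (by fun_prop) (by fun_prop) (fun η h => by positivity)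
    (fun η h => by positivity) (by simp) hp1 hp2 hε
  have huc := (isCompact_Icc (a := -N' - 1) (b := N' + 1)).prod
    (isCompact_Icc (a := -N - 1) (b := N + 1)) |>.uniformContinuousOn_of_continuous
      hK.continuousOn
  obtain ⟨δ, hδ, hδK⟩ := Metric.uniformContinuousOn_iff.1 huc η hη
  obtain ⟨s, hs0, hs1, hsδ⟩ : ∃ s : ℝ, 0 < s ∧ s ≤ 1 ∧ s < δ :=
    ⟨min 1 (δ / 2), by positivity, min_le_left _ _,
      (min_le_right _ _).trans_lt (by linarith)⟩
  let d : ℝ → ℝ := fun x => ⌊x / s⌋ * s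
  have hd1 : ∀ x, d x ≤ x := fun x => by
    have := Int.floor_le (x / s)
    rwa [le_div_iff₀ hs0] at this
  have hd2 : ∀ x, x < d x + s := fun x => by
    have := Int.lt_floor_add_one (x / s)
    rw [div_lt_iff₀ hs0] at this
    simp only [d]
    linarith
  have hdm : Measurable d := by fun_prop
  let K' : ℝ → ℝ → ℝ := fun x t =>
    (J ×ˢ I).indicator (fun z : ℝ × ℝ => K (d z.1) z.2) (x, t)
  have hK'm : Measurable (Function.uncurry K') :=
    (hK.measurable.comp ((hdm.comp measurable_fst).prodMk measurable_snd)).indicator hIm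
  have hclose : ∀ x ∈ J, ∀ t ∈ I, ‖K x t - K (d x) t‖ ≤ η := by
    intro x hx t ht
    have h1 := hd1 x
    have h2 := hd2 x
    rw [hJ, Set.mem_Icc] at hx
    rw [hI, Set.mem_Icc] at ht
    have := hδK (x, t) ⟨⟨by linarith, by linarith⟩, ⟨by linarith, by linarith⟩⟩ (d x, t)
      ⟨⟨by linarith, by linarith⟩, ⟨by linarith, by linarith⟩⟩ (by
        rw [Prod.dist_eq, dist_self, Real.dist_eq, max_lt_iff, abs_lt]
        exact ⟨⟨by linarith, by linarith⟩, hδ⟩)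
    rw [dist_eq_norm] at this
    exact this.le
  have hdiff : SchurBound volume
      (fun x t => (J ×ˢ I).indicator (Function.uncurry K) (x, t) - K' x t)
      (ENNReal.ofReal (η * (2 * N))) (ENNReal.ofReal (η * (2 * N'))) := by
    have hpt : ∀ x t, ‖(J ×ˢ I).indicator (Function.uncurry K) (x, t) - K' x t‖ₑ ≤
        (J ×ˢ I).indicator (fun _ => ENNReal.ofReal η) (x, t) := by
      intro x t
      by_cases hxt : (x, t) ∈ J ×ˢ I
      · simp only [K', Set.indicator_of_mem hxt, Function.uncurry]
        rw [← ofReal_norm]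
        exact ENNReal.ofReal_le_ofReal (hclose x hxt.1 t hxt.2)
      · simp [K', Set.indicator_of_notMem hxt]
    have hint : ∀ R : ℝ, ∫⁻ t, (Set.Icc (-R) R).indicator (fun _ => ENNReal.ofReal η) t =
        ENNReal.ofReal (η * (2 * R)) := fun R => by
      rw [lintegral_indicator_const measurableSet_Icc, Real.volume_Icc,
        ← ENNReal.ofReal_mul hη.le]
      congr 2
      ring
    refine ⟨(hK.measurable.indicator hIm).sub hK'm, fun x => ?_, fun t => ?_⟩
    · rw [← hint N]
      refine lintegral_mono fun t => (hpt x t).trans ?_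
      by_cases hx : x ∈ J <;> by_cases ht : t ∈ I <;> simp [hx, ht, ← hI]
    · rw [← hint N']
      refine lintegral_mono fun x => (hpt x t).trans ?_
      by_cases hx : x ∈ J <;> by_cases ht : t ∈ I <;> simp [hx, ht, ← hJ]
  refine ⟨K', _, _, ENNReal.ofReal_ne_top, ENNReal.ofReal_ne_top, hdiff, hlt, ?_⟩
  have hK'b : SchurBound volume K' (A + ENNReal.ofReal (η * (2 * N)))
      (B + ENNReal.ofReal (η * (2 * N'))) :=
    hbound.of_enorm_le_add hdiff hK'm fun x t => by
      rw [enorm_sub_rev]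
      exact le_trans (by simp) (enorm_add_le _ _)
  refine hK'b.isCompactKernel_of_finite (by simp [hA]) (by simp [hB]) hp1 hp2
    (c := fun x => ⌊x / s⌋) (by fun_prop) (E := J) measurableSet_Icc (by simp [hJ])
    (Finset.Icc ⌊-N' / s⌋ ⌊N' / s⌋) (fun x hx => ?_) (fun j => I.indicator (K (j * s)))
    (fun x hx => ?_) (fun x hx => ?_)
  · rw [Finset.mem_Icc]
    exact ⟨Int.floor_mono (by gcongr; exact hx.1), Int.floor_mono (by gcongr; exact hx.2)⟩
  · ext t
    by_cases ht : t ∈ I <;> simp [K', hx, ht, d]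
  · ext t
    simp [K', hx]

/-- A continuous symmetric kernel with finite Schur bound and uniformly small tails defines a
compact operator on every `L_p`, `1 < p < ∞`. -/
theorem isCompactKernel_of_continuous_of_tail {K : ℝ → ℝ → ℝ}
    (hK : Continuous (Function.uncurry K)) (hsymm : ∀ x t, K x t = K t x) {M : ℝ} (hM : 0 ≤ M)
    (h : SchurBound volume K (ENNReal.ofReal M) (ENNReal.ofReal M))
    (htail : ∀ η : ℝ, 0 < η → ∃ N : ℝ, 0 ≤ N ∧
      ∀ x, ∫⁻ t in (Set.Icc (-N) N)ᶜ, ‖K x t‖ₑ ≤ ENNReal.ofReal η)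
    {p : ℝ≥0∞} [Fact (1 ≤ p)] (hp1 : 1 < p) (hp2 : p ≠ ⊤) :
    IsCompactKernel volume p K := by
  refine h.isCompactKernel_of_approx ENNReal.ofReal_ne_top ENNReal.ofReal_ne_top hp1 hp2
    fun ε hε => ?_
  obtain ⟨η, hη, hlt⟩ := exists_toReal_schurConst_lt (a := fun η => η) (b := fun _ => M)
    (by fun_prop) (by fun_prop) (fun η h => h.le) (fun _ _ => hM) (by simp) hp1 hp2 hε
  obtain ⟨N, hN, htN⟩ := htail η hη
  set I := Set.Icc (-N) N with hI
  have hIm : MeasurableSet I := measurableSet_Icc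
  let K₁ : ℝ → ℝ → ℝ := fun x t => (Prod.snd ⁻¹' I).indicator (Function.uncurry K) (x, t)
  have hK₁m : Measurable (Function.uncurry K₁) := hK.measurable.indicator (measurable_snd hIm)
  have hK₁ : SchurBound volume K₁ (ENNReal.ofReal M) (ENNReal.ofReal M) :=
    h.of_enorm_le hK₁m fun x t => by
      by_cases ht : t ∈ I <;> simp [K₁, ht, Function.uncurry]
  have hdm : Measurable (Function.uncurry fun x t => K x t - K₁ x t) := hK.measurable.sub hK₁m
  have hdiff : SchurBound volume (fun x t => K x t - K₁ x t) (ENNReal.ofReal η)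
      (ENNReal.ofReal M) := by
    refine ⟨hdm, fun x => ?_, (h.of_enorm_le hdm fun x t => ?_).col⟩
    · refine le_trans (le_of_eq ?_) (htN x)
      rw [← lintegral_indicator hIm.compl]
      refine lintegral_congr fun t => ?_
      by_cases ht : t ∈ I <;> simp [K₁, ht, Function.uncurry]
    · by_cases ht : t ∈ I <;> simp [K₁, ht, Function.uncurry]
  refine ⟨K₁, _, _, ENNReal.ofReal_ne_top, ENNReal.ofReal_ne_top, hdiff, hlt, ?_⟩
  refine hK₁.isCompactKernel_of_approx ENNReal.ofReal_ne_top ENNReal.ofReal_ne_top hp1 hp2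
    fun ε hε => ?_
  obtain ⟨η', hη', hlt'⟩ := exists_toReal_schurConst_lt (a := fun _ => M) (b := fun η => η)
    (by fun_prop) (by fun_prop) (fun _ _ => hM) (fun η h => h.le) (by simp) hp1 hp2 hε
  obtain ⟨N', hN', htN'⟩ := htail η' hη'
  set J := Set.Icc (-N') N' with hJ
  have hJm : MeasurableSet J := measurableSet_Icc
  let K₂ : ℝ → ℝ → ℝ := fun x t => (J ×ˢ I).indicator (Function.uncurry K) (x, t)
  have hdm' : Measurable (Function.uncurry fun x t => K₁ x t - K₂ x t) :=
    hK₁m.sub (hK.measurable.indicator (hJm.prod hIm))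
  refine ⟨K₂, _, _, ENNReal.ofReal_ne_top, ENNReal.ofReal_ne_top,
    ⟨hdm', (hK₁.of_enorm_le hdm' fun x t => ?_).row, fun t => ?_⟩, hlt',
    isCompactKernel_indicator_of_continuous hK h ENNReal.ofReal_ne_top ENNReal.ofReal_ne_top
      hp1 hp2 hN' hN⟩
  · by_cases hx : x ∈ J <;> by_cases ht : t ∈ I <;> simp [K₁, K₂, hx, ht, Function.uncurry]
  · refine le_trans ?_ (htN' t)
    rw [← lintegral_indicator hJm.compl]
    refine lintegral_mono fun x => ?_
    by_cases hx : x ∈ J <;> by_cases ht : t ∈ I <;>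
      simp [K₁, K₂, hx, ht, Function.uncurry, hsymm x t]

theorem greenKernel_eq (u v : ℝ → ℝ) (x t : ℝ) :
    greenKernel u v x t = u (max x t) * v (min x t) := by
  unfold greenKernel
  split_ifs with h
  · rw [max_eq_left h, min_eq_right h]
  · rw [max_eq_right (not_le.1 h).le, min_eq_left (not_le.1 h).le]

theorem greenKernel_symm (u v : ℝ → ℝ) (x t : ℝ) : greenKernel u v x t = greenKernel u v t x := by
  rw [greenKernel_eq, greenKernel_eq, max_comm, min_comm]

namespace PFSS

variable {r q u v u' v' : ℝ → ℝ}

theorem continuous_u (h : PFSS r q u v u' v') : Continuous u := by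
  have : u = fun x => u 0 + ∫ t in (0 : ℝ)..x, u' t := by
    ext x
    rw [← h.u_deriv]
    ring
  rw [this]
  exact continuous_const.add (intervalIntegral.continuous_primitive h.u'_intble 0)

theorem continuous_v (h : PFSS r q u v u' v') : Continuous v := by
  have : v = fun x => v 0 + ∫ t in (0 : ℝ)..x, v' t := by
    ext x
    rw [← h.v_deriv]
    ring
  rw [this]
  exact continuous_const.add (intervalIntegral.continuous_primitive h.v'_intble 0)

theorem antitone_u (h : PFSS r q u v u' v') : Antitone u := fun a b hab => by
  have h1 := intervalIntegral.integral_nonneg (μ := volume) hab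
    (fun t _ => neg_nonneg.2 (h.u'_nonpos t))
  rw [intervalIntegral.integral_neg, ← h.u_deriv a b] at h1
  linarith

theorem monotone_v (h : PFSS r q u v u' v') : Monotone v := fun a b hab => by
  have h1 := intervalIntegral.integral_nonneg (μ := volume) hab (fun t _ => h.v'_nonneg t)
  rw [← h.v_deriv a b] at h1
  linarith

theorem continuous_greenKernel (h : PFSS r q u v u' v') :
    Continuous (Function.uncurry (greenKernel u v)) := by
  have : Function.uncurry (greenKernel u v) =
      fun z : ℝ × ℝ => u (max z.1 z.2) * v (min z.1 z.2) := by
    ext ⟨x, t⟩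
    exact greenKernel_eq u v x t
  rw [this]
  have hu := h.continuous_u
  have hv := h.continuous_v
  fun_prop

theorem greenKernel_nonneg (h : PFSS r q u v u' v') (x t : ℝ) : 0 ≤ greenKernel u v x t := by
  rw [greenKernel_eq]
  exact mul_nonneg (h.u_pos _).le (h.v_pos _).le

theorem greenKernel_le (h : PFSS r q u v u' v') (x t : ℝ) :
    greenKernel u v x t ≤ u t * v t := by
  rw [greenKernel_eq]
  exact mul_le_mul (h.antitone_u (le_max_right x t)) (h.monotone_v (min_le_right x t))
    (h.v_pos _).le (h.u_pos _).le

theorem integral_q_mul_greenKernel_le (h : PFSS r q u v u' v') (h12 : Cond12 r q) {a x b : ℝ}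
    (hax : a ≤ x) (hxb : x ≤ b) :
    ∫ t in a..b, q t * greenKernel u v x t ≤ 1 := by
  obtain ⟨-, -, hr, -, -, hq⟩ := h12
  have hint : ∀ c d, IntervalIntegrable (fun t => q t * greenKernel u v x t) volume c d :=
    fun c d => (hq.integrableOn_isCompact isCompact_uIcc).intervalIntegrable.mul_continuousOn
      (h.continuous_greenKernel.comp (by fun_prop : Continuous fun t => (x, t))).continuousOn
  have h1 : ∫ t in a..x, q t * greenKernel u v x t = u x * ∫ t in a..x, q t * v t := by
    rw [← intervalIntegral.integral_const_mul]
    refine intervalIntegral.integral_congr fun t ht => ?_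
    rw [Set.uIcc_of_le hax] at ht
    simp only [greenKernel, if_pos ht.2]
    ring
  have h2 : ∫ t in x..b, q t * greenKernel u v x t = v x * ∫ t in x..b, q t * u t := by
    rw [← intervalIntegral.integral_const_mul]
    refine intervalIntegral.integral_congr fun t ht => ?_
    rw [Set.uIcc_of_le hxb] at ht
    simp only [greenKernel_eq, max_eq_right ht.1, min_eq_left ht.1]
    ring
  rw [← intervalIntegral.integral_add_adjacent_intervals (hint a x) (hint x b), h1, h2,
    ← h.rv'_deriv, ← h.ru'_deriv]
  have ha : 0 ≤ u x * (r a * v' a) :=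
    mul_nonneg (h.u_pos x).le (mul_nonneg (hr a).le (h.v'_nonneg a))
  have hb : 0 ≤ v x * (r b * -u' b) :=
    mul_nonneg (h.v_pos x).le (mul_nonneg (hr b).le (neg_nonneg.2 (h.u'_nonpos b)))
  have hw := h.wronskian x
  nlinarith

theorem lintegral_q_mul_greenKernel_le (h : PFSS r q u v u' v') (h12 : Cond12 r q) (x : ℝ) :
    ∫⁻ t, ENNReal.ofReal (q t * greenKernel u v x t) ≤ 1 := by
  have hc : Continuous fun t => greenKernel u v x t :=
    h.continuous_greenKernel.comp (by fun_prop : Continuous fun t => (x, t))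
  have hm : Measurable fun t => ENNReal.ofReal (q t * greenKernel u v x t) :=
    (h12.2.1.mul hc.measurable).ennreal_ofReal
  have hcov : AECover (volume : Measure ℝ) atTop fun R : ℝ => Set.Ioc (-R) R :=
    aecover_Ioc tendsto_neg_atTop_atBot tendsto_id
  refine le_of_tendsto (hcov.lintegral_tendsto_of_countably_generated hm.aemeasurable) ?_
  filter_upwards [eventually_ge_atTop |x|] with R hR
  obtain ⟨h1, h2⟩ := abs_le.1 hR
  have hint : IntegrableOn (fun t => q t * greenKernel u v x t) (Set.Ioc (-R) R) :=
    ((h12.2.2.2.2.2.integrableOn_isCompact isCompact_uIcc).intervalIntegrable.mul_continuousOn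
      hc.continuousOn).1
  rw [← ofReal_integral_eq_lintegral_ofReal hint
    (Eventually.of_forall fun t => mul_nonneg (h12.2.2.2.1 t) (h.greenKernel_nonneg x t)),
    ← intervalIntegral.integral_of_le (h1.trans h2)]
  exact ENNReal.ofReal_le_one.2 (h.integral_q_mul_greenKernel_le h12 h1 h2)

theorem exists_lintegral_compl_greenKernel_le (h : PFSS r q u v u' v') (h12 : Cond12 r q)
    (hq : Tendsto q (cocompact ℝ) atTop) {η : ℝ} (hη : 0 < η) :
    ∃ N : ℝ, 0 ≤ N ∧
      ∀ x, ∫⁻ t in (Set.Icc (-N) N)ᶜ, ‖greenKernel u v x t‖ₑ ≤ ENNReal.ofReal η := by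
  obtain ⟨S, hS, hSq⟩ := (Filter.hasBasis_cocompact.eventually_iff).1 (hq.eventually_ge_atTop η⁻¹)
  obtain ⟨N, hN⟩ := hS.isBounded.subset_closedBall 0
  have hNq : ∀ t ∈ (Set.Icc (-max N 0) (max N 0))ᶜ, η⁻¹ ≤ q t := by
    intro t ht
    refine hSq fun htS => ht ?_
    have := hN htS
    rw [Real.closedBall_eq_Icc, zero_sub, zero_add] at this
    exact Set.Icc_subset_Icc (neg_le_neg (le_max_left _ _)) (le_max_left _ _) this
  refine ⟨max N 0, le_max_right _ _, fun x => ?_⟩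
  calc ∫⁻ t in (Set.Icc (-max N 0) (max N 0))ᶜ, ‖greenKernel u v x t‖ₑ
      ≤ ∫⁻ t in (Set.Icc (-max N 0) (max N 0))ᶜ,
          ENNReal.ofReal η * ENNReal.ofReal (q t * greenKernel u v x t) := by
        refine setLIntegral_mono' measurableSet_Icc.compl fun t ht => ?_
        rw [Real.enorm_of_nonneg (h.greenKernel_nonneg x t), ← ENNReal.ofReal_mul hη.le]
        refine ENNReal.ofReal_le_ofReal ?_
        have h1 : 1 ≤ η * q t := by
          have := mul_le_mul_of_nonneg_left (hNq t ht) hη.le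
          rwa [mul_inv_cancel₀ hη.ne'] at this
        nlinarith [h.greenKernel_nonneg x t]
    _ ≤ ∫⁻ t, ENNReal.ofReal η * ENNReal.ofReal (q t * greenKernel u v x t) :=
        setLIntegral_le_lintegral _ _
    _ = ENNReal.ofReal η * ∫⁻ t, ENNReal.ofReal (q t * greenKernel u v x t) :=
        lintegral_const_mul' _ _ ENNReal.ofReal_ne_top
    _ ≤ ENNReal.ofReal η * 1 := by
        gcongr
        exact h.lintegral_q_mul_greenKernel_le h12 x
    _ = ENNReal.ofReal η := mul_one _

theorem exists_schurBound_greenKernel (h : PFSS r q u v u' v') (h12 : Cond12 r q)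
    (hq : Tendsto q (cocompact ℝ) atTop) :
    ∃ M : ℝ, 0 ≤ M ∧
      SchurBound volume (greenKernel u v) (ENNReal.ofReal M) (ENNReal.ofReal M) := by
  obtain ⟨N, -, hN⟩ := h.exists_lintegral_compl_greenKernel_le h12 hq one_pos
  have hρ : IntegrableOn (fun t => u t * v t) (Set.Icc (-N) N) :=
    (h.continuous_u.mul h.continuous_v).continuousOn.integrableOn_Icc
  have hρ0 : 0 ≤ ∫ t in Set.Icc (-N) N, u t * v t :=
    setIntegral_nonneg measurableSet_Icc fun t _ => mul_nonneg (h.u_pos t).le (h.v_pos t).le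
  have hrow : ∀ x, ∫⁻ t, ‖greenKernel u v x t‖ₑ ≤
      ENNReal.ofReal ((∫ t in Set.Icc (-N) N, u t * v t) + 1) := by
    intro x
    rw [← lintegral_add_compl _ (measurableSet_Icc (a := -N) (b := N)),
      ENNReal.ofReal_add hρ0 zero_le_one]
    refine add_le_add ?_ (hN x)
    rw [ofReal_integral_eq_lintegral_ofReal hρ
      (Eventually.of_forall fun t => mul_nonneg (h.u_pos t).le (h.v_pos t).le)]
    refine lintegral_mono fun t => ?_
    rw [Real.enorm_of_nonneg (h.greenKernel_nonneg x t)]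
    exact ENNReal.ofReal_le_ofReal (h.greenKernel_le x t)
  refine ⟨_, by positivity, h.continuous_greenKernel.measurable, hrow, fun t => ?_⟩
  simp only [greenKernel_symm u v _ t]
  exact hrow t

end PFSS

/-- **Corollary 3.8.** Assume (1.2) and `q(x) → ∞` as `|x| → ∞`, and let
`u, v` be a principal FSS.  Then for every `p ∈ (1,∞)` the Green operator is a
bounded and compact operator on `L_p(ℝ)`. -/
theorem compact_green_of_q_tendsto_atTop
    (r q u v u' v' : ℝ → ℝ) (p : ℝ≥0∞) (hp1 : 1 < p) (hp2 : p ≠ ⊤)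
    [Fact (1 ≤ p)]
    (h12 : Cond12 r q) (hq : Tendsto q (cocompact ℝ) atTop)
    (hfss : PFSS r q u v u' v') :
    ∃ G : LpR p →L[ℝ] LpR p, IsGreenOp u v p G ∧ IsCompactOperator G := by
  obtain ⟨M, hM, hs⟩ := hfss.exists_schurBound_greenKernel h12 hq
  obtain ⟨-, G, hG, hc⟩ := isCompactKernel_of_continuous_of_tail hfss.continuous_greenKernel
    (greenKernel_symm u v) hM hs
    (fun _ hη => hfss.exists_lintegral_compl_greenKernel_le h12 hq hη) hp1 hp2
  exact ⟨G, hG, hc⟩
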